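/- arXiv:1501.01344 — 3 statements merged into one kernel-verified Lean document; each statement's English description precedes it below -/
import Mathlib

section
/- Let q be a prime number. Let k ∈ GL₂(ℤ_q) be a matrix whose reduction modulo q is upper triangular with both diagonal entries equal to 1, let z ∈ ℚ_q^×, and set g = z·k ∈ GL₂(ℚ_q). If g^h is a scalar matrix for some integer h with 1 ≤ h < q, then g itself is a scalar matrix. -/
/-- Modulo an ideal containing `tr A - 2` and `det A - 1`, the powers of a `2 × 2` matrix `A`
behave as those of a unipotent matrix: `A ^ n = u A + v` with `u ≡ n` and `v ≡ 1 - n`. -/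
lemma Matrix.exists_pow_eq_smul_add_smul_one {R : Type*} [CommRing R] (I : Ideal R)
    (A : Matrix (Fin 2) (Fin 2) R) (htr : A.trace - 2 ∈ I) (hdet : A.det - 1 ∈ I) (n : ℕ) :
    ∃ u v : R, A ^ n = u • A + v • (1 : Matrix (Fin 2) (Fin 2) R) ∧
      u - n ∈ I ∧ v - (1 - n) ∈ I := by
  have hsq : A * A = A.trace • A - A.det • (1 : Matrix (Fin 2) (Fin 2) R) := by
    ext i j
    fin_cases i <;> fin_cases j <;>
      simp [Matrix.mul_apply, Fin.sum_univ_two, Matrix.trace_fin_two, Matrix.det_fin_two] <;> ring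
  induction n with
  | zero => exact ⟨0, 1, by simp, by simp, by simp⟩
  | succ n ih =>
    obtain ⟨u, v, hA, hu, hv⟩ := ih
    refine ⟨u * A.trace + v, -(u * A.det), ?_, ?_, ?_⟩
    · rw [pow_succ, hA, add_mul, smul_mul_assoc, smul_mul_assoc, one_mul, hsq]
      module
    · convert I.add_mem (I.add_mem (I.mul_mem_left u htr) (I.mul_mem_left 2 hu)) hv using 1
      push_cast
      ring
    · convert I.neg_mem (I.add_mem (I.mul_mem_left u hdet) hu) using 1
      push_cast
      ring

/-- The residue of a natural number `0 < h < q` is nonzero in `ℤ_q / q`. -/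
lemma PadicInt.natCast_notMem_span_of_lt (q : ℕ) [Fact (Nat.Prime q)] {h : ℕ}
    (h1 : 1 ≤ h) (h2 : h < q) : (h : ℤ_[q]) ∉ Ideal.span {(q : ℤ_[q])} := by
  rw [Ideal.mem_span_singleton, ← PadicInt.norm_lt_one_iff_dvd]
  have := PadicInt.norm_int_lt_one_iff_dvd (p := q) (h : ℤ)
  rw [Int.cast_natCast, Int.natCast_dvd_natCast] at this
  rw [this]
  exact Nat.not_dvd_of_pos_of_lt h1 h2

/-- Let `q` be a prime.  Let `k ∈ GL₂(ℤ_q)` be a matrix whose reduction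
modulo `q` is upper triangular with both diagonal entries equal to `1`, let `z ∈ ℚ_q^×`,
and set `g = z·k ∈ GL₂(ℚ_q)`.  If `g^h` is a scalar matrix for some integer `h` with
`1 ≤ h < q`, then `g` itself is a scalar matrix. -/
theorem scalar_of_pow_scalar_Iwahori
    (q : ℕ) [Fact (Nat.Prime q)]
    (k : GL (Fin 2) ℤ_[q])
    (h00 : (k : Matrix (Fin 2) (Fin 2) ℤ_[q]) 0 0 - 1 ∈ Ideal.span {(q : ℤ_[q])})
    (h11 : (k : Matrix (Fin 2) (Fin 2) ℤ_[q]) 1 1 - 1 ∈ Ideal.span {(q : ℤ_[q])})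
    (h10 : (k : Matrix (Fin 2) (Fin 2) ℤ_[q]) 1 0 ∈ Ideal.span {(q : ℤ_[q])})
    (z : ℚ_[q]ˣ)
    (g : Matrix (Fin 2) (Fin 2) ℚ_[q])
    (hg : g = (z : ℚ_[q]) • (k : Matrix (Fin 2) (Fin 2) ℤ_[q]).map (fun x => (x : ℚ_[q])))
    (h : ℕ) (h1 : 1 ≤ h) (h2 : h < q)
    (hpow : ∃ c : ℚ_[q]ˣ, g ^ h = (c : ℚ_[q]) • (1 : Matrix (Fin 2) (Fin 2) ℚ_[q])) :
    ∃ c : ℚ_[q]ˣ, g = (c : ℚ_[q]) • (1 : Matrix (Fin 2) (Fin 2) ℚ_[q]) := by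
  obtain ⟨c, hc⟩ := hpow
  set A : Matrix (Fin 2) (Fin 2) ℤ_[q] := (k : Matrix (Fin 2) (Fin 2) ℤ_[q])
  set I : Ideal ℤ_[q] := Ideal.span {(q : ℤ_[q])}
  have htr : A.trace - 2 ∈ I := by
    convert I.add_mem h00 h11 using 1
    rw [Matrix.trace_fin_two]
    ring
  have hdet : A.det - 1 ∈ I := by
    convert I.sub_mem (I.add_mem (I.mul_mem_right (A 1 1) h00) h11)
      (I.mul_mem_left (A 0 1) h10) using 1
    rw [Matrix.det_fin_two]
    ring
  obtain ⟨u, v, hpow, hu, -⟩ := A.exists_pow_eq_smul_add_smul_one I htr hdet h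
  have hu0 : u ≠ 0 := by
    rintro rfl
    exact PadicInt.natCast_notMem_span_of_lt q h1 h2 (by simpa using hu)
  have hA0 : A 0 0 ≠ 0 := by
    intro h0
    refine PadicInt.natCast_notMem_span_of_lt q le_rfl (h1.trans_lt h2) ?_
    simpa [h0] using h00
  have hz : (z : ℚ_[q]) ^ h ≠ 0 := pow_ne_zero _ z.ne_zero
  have hgpow : g ^ h = (z : ℚ_[q]) ^ h • (A ^ h).map PadicInt.Coe.ringHom := by
    rw [Matrix.map_pow, ← smul_pow, hg]
    rfl
  rw [hgpow, hpow] at hc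
  have entry (i j : Fin 2) : (z : ℚ_[q]) ^ h *
      ((u * A i j + v * (1 : Matrix (Fin 2) (Fin 2) ℤ_[q]) i j : ℤ_[q]) : ℚ_[q]) =
      c * (1 : Matrix (Fin 2) (Fin 2) ℚ_[q]) i j := congrFun (congrFun hc i) j
  have hoff {i j : Fin 2} (hij : i ≠ j) : A i j = 0 := by
    have := entry i j
    simpa [hij, hz, hu0] using this
  have hdiag : A 0 0 = A 1 1 := by
    have := (entry 0 0).trans (by simpa using (entry 1 1).symm)
    exact Subtype.ext (by simpa [hz, hu0] using this)
  refine ⟨z * Units.mk0 (A 0 0 : ℚ_[q]) (by simpa using hA0), ?_⟩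
  rw [hg]
  ext i j
  fin_cases i <;> fin_cases j <;> simp [hoff, hdiag]
end

section
/- Let G be a group, N a normal subgroup of G, and π : G → S₃ a surjective group homomorphism with kernel N. Let V = {(x, y, z) ∈ 𝔽₂³ : x + y + z = 0}, with S₃ permuting coordinates. Let f₁, …, f_r : N → V be group homomorphisms satisfying f_i(g n g⁻¹) = π(g)·f_i(n) for all g ∈ G, n ∈ N, and suppose f₁, …, f_r are linearly independent over 𝔽₂ (no nonempty subset sums to the zero homomorphism). Then the map N → V^r sending n to (f₁(n), …, f_r(n)) is surjective. -/
/-- The 2-dimensional standard representation space: vectors in `k³` with coordinate sum 0. -/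
def V3 (k : Type*) [Field k] : Submodule k (Fin 3 → k) where
  carrier := {v | v 0 + v 1 + v 2 = 0}
  add_mem' := by
    intro a b ha hb
    simp only [Set.mem_setOf_eq, Pi.add_apply] at *
    linear_combination ha + hb
  zero_mem' := by simp
  smul_mem' := by
    intro c a ha
    simp only [Set.mem_setOf_eq, Pi.smul_apply, smul_eq_mul] at *
    linear_combination c * ha

lemma mem_V3 {k : Type*} [Field k] (v : Fin 3 → k) : v ∈ V3 k ↔ v 0 + v 1 + v 2 = 0 :=
  Iff.rfl

lemma permSum {k : Type*} [Field k] (τ : Equiv.Perm (Fin 3)) (v : Fin 3 → k) :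
    v (τ 0) + v (τ 1) + v (τ 2) = v 0 + v 1 + v 2 := by
  have h := Equiv.sum_comp τ v
  simpa [Fin.sum_univ_three] using h

/-- The linear action of a permutation `σ` on `V3 k` by permuting coordinates
(`(σ • v) i = v (σ⁻¹ i)`). -/
def permMap (k : Type*) [Field k] (σ : Equiv.Perm (Fin 3)) : V3 k →ₗ[k] V3 k where
  toFun v := ⟨fun i => (v : Fin 3 → k) (σ⁻¹ i), by
    rw [mem_V3, permSum σ⁻¹ (v : Fin 3 → k)]
    exact v.2⟩
  map_add' v w := rfl
  map_smul' c v := rfl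

/-- The representation of `S₃` on `V3 k` by permuting the three coordinates. -/
def permRep (k : Type*) [Field k] : Representation k (Equiv.Perm (Fin 3)) (V3 k) where
  toFun σ := permMap k σ
  map_one' := by
    apply LinearMap.ext; intro v; apply Subtype.ext; funext i
    simp [permMap]
  map_mul' σ τ := by
    apply LinearMap.ext; intro v; apply Subtype.ext; funext i
    simp [permMap]


/-- Over `𝔽₂`, every rank one operator `v ↦ v j • w` on `V3` is a sum of two permutations. -/
lemma exists_permRep_add_permRep_eq_smul (j : Fin 3) (w : V3 (ZMod 2)) :
    ∃ σ τ : Equiv.Perm (Fin 3), ∀ v : V3 (ZMod 2),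
      permRep (ZMod 2) σ v + permRep (ZMod 2) τ v = (v : Fin 3 → ZMod 2) j • w := by
  have key : ∀ (j : Fin 3) (w : Fin 3 → ZMod 2), w 0 + w 1 + w 2 = 0 →
      ∃ σ τ : Equiv.Perm (Fin 3), ∀ v : Fin 3 → ZMod 2, v 0 + v 1 + v 2 = 0 →
        ∀ i, v (σ⁻¹ i) + v (τ⁻¹ i) = v j * w i := by
    decide +kernel
  obtain ⟨σ, τ, h⟩ := key j w w.2
  exact ⟨σ, τ, fun v => Subtype.ext (funext (h v v.2))⟩

/-- Let `G` be a group, `N ⊴ G`, `π : G → S₃` a surjection with kernel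
`N`, and `V = {(x,y,z) ∈ 𝔽₂³ : x+y+z=0}` with `S₃` permuting coordinates.  If
`f₁, …, f_r : N → V` are `S₃`-equivariant group homomorphisms which are linearly
independent over `𝔽₂`, then `n ↦ (f₁(n), …, f_r(n))` is surjective onto `V^r`. -/
theorem surjective_of_linearIndependent_equivariant
    {G : Type*} [Group G] (N : Subgroup G) (hN : N.Normal)
    (π : G →* Equiv.Perm (Fin 3)) (hsurj : Function.Surjective π) (hker : π.ker = N)
    (r : ℕ) (fs : Fin r → (↥N → ↥(V3 (ZMod 2))))
    (hhom : ∀ i, ∀ m n : ↥N, fs i (m * n) = fs i m + fs i n)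
    (hequiv : ∀ i (g : G) (n : ↥N),
      fs i ⟨g * ↑n * g⁻¹, hN.conj_mem ↑n n.2 g⟩ = permRep (ZMod 2) (π g) (fs i n))
    (hli : LinearIndependent (ZMod 2) fs) :
    Function.Surjective (fun n : ↥N => (fun i => fs i n : Fin r → ↥(V3 (ZMod 2)))) := by
  let F : Additive N →+ (Fin r → V3 (ZMod 2)) :=
    AddMonoidHom.mk' (fun n i => fs i n.toMul) fun m n => funext fun i => hhom i m.toMul n.toMul
  let W : Submodule (ZMod 2) (Fin r → V3 (ZMod 2)) := AddSubgroup.toZModSubmodule 2 F.range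
  have perm_mem (σ : Equiv.Perm (Fin 3)) (n : N) :
      (fun i => permRep (ZMod 2) σ (fs i n)) ∈ W := by
    obtain ⟨g, rfl⟩ := hsurj σ
    exact ⟨Additive.ofMul ⟨g * n.1 * g⁻¹, hN.conj_mem n.1 n.2 g⟩, funext fun i => hequiv i g n⟩
  have smul_mem (j : Fin 3) (w : V3 (ZMod 2)) (n : N) :
      (fun i => (fs i n : Fin 3 → ZMod 2) j • w) ∈ W := by
    obtain ⟨σ, τ, h⟩ := exists_permRep_add_permRep_eq_smul j w
    simp_rw [← h]
    exact W.add_mem (perm_mem σ n) (perm_mem τ n)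
  have hW : W = ⊤ := by
    by_contra hne
    obtain ⟨φ, hφ, hle⟩ := W.exists_le_ker_of_lt_top (lt_top_iff_ne_top.mpr hne)
    refine hφ (LinearMap.pi_ext fun i w => ?_)
    refine Fintype.linearIndependent_iff.mp hli (fun i => φ (Pi.single i w)) ?_ i
    funext n
    refine Subtype.ext (funext fun j => ?_)
    have h : φ (fun i => (fs i n : Fin 3 → ZMod 2) j • w) = 0 := hle (smul_mem j w n)
    rw [← Finset.univ_sum_single (fun i => (fs i n : Fin 3 → ZMod 2) j • w), map_sum] at h
    simpa [Pi.single_smul, mul_comm] using h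
  intro v
  obtain ⟨n, hn⟩ : v ∈ W := hW ▸ Submodule.mem_top
  exact ⟨n.toMul, hn⟩
end

section
/- Let G be a group, N a normal subgroup of G, and π : G → S₃ a surjective group homomorphism with kernel N. Let V = {(x, y, z) ∈ 𝔽₂³ : x + y + z = 0}, with S₃ permuting coordinates. Let f : N → V be a nonzero group homomorphism satisfying f(g n g⁻¹) = π(g)·f(n) for all g ∈ G, n ∈ N. Then there exists g ∈ G such that π(g) has order 2 in S₃ and f(g²) ≠ 0 (note g² ∈ N since π(g²) = 1). -/
lemma exists_ne_of_mem_V3 {w : Fin 3 → ZMod 2} (hw : w ∈ V3 (ZMod 2)) (h0 : w ≠ 0) :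
    ∃ i j, w i ≠ w j := by
  by_contra! h
  rw [mem_V3, h 1 0, h 2 0] at hw
  have hz : ∀ c : ZMod 2, c + c + c = 0 → c = 0 := by decide
  exact h0 (funext fun i => (h i 0).trans (hz _ hw))

lemma permRep_swap_add_self_ne_zero (w : V3 (ZMod 2)) {i j : Fin 3}
    (hij : (w : Fin 3 → ZMod 2) i ≠ (w : Fin 3 → ZMod 2) j) :
    permRep (ZMod 2) (Equiv.swap i j) w + w ≠ 0 := by
  intro h
  have hi : (w : Fin 3 → ZMod 2) ((Equiv.swap i j)⁻¹ i) + (w : Fin 3 → ZMod 2) i = 0 :=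
    congrFun (congrArg Subtype.val h) i
  rw [Equiv.swap_inv, Equiv.swap_apply_left] at hi
  exact hij (CharTwo.add_eq_zero.mp hi).symm

/-- Let `G` be a group, `N ⊴ G`, `π : G → S₃` a surjection with kernel
`N`, and `V = {(x,y,z) ∈ 𝔽₂³ : x+y+z=0}` with `S₃` permuting coordinates.  If
`f : N → V` is a nonzero `S₃`-equivariant group homomorphism, then there exists `g ∈ G`
such that `π g` has order 2 and `f(g²) ≠ 0`. -/
theorem exists_order_two_with_f_sq_ne_zero
    {G : Type*} [Group G] (N : Subgroup G) (hN : N.Normal)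
    (π : G →* Equiv.Perm (Fin 3)) (hsurj : Function.Surjective π) (hker : π.ker = N)
    (f : ↥N → ↥(V3 (ZMod 2)))
    (hhom : ∀ m n : ↥N, f (m * n) = f m + f n)
    (hequiv : ∀ (g : G) (n : ↥N),
      f ⟨g * ↑n * g⁻¹, hN.conj_mem ↑n n.2 g⟩ = permRep (ZMod 2) (π g) (f n))
    (hf : f ≠ 0) :
    ∃ (g : G) (hg : g ^ 2 ∈ N), orderOf (π g) = 2 ∧ f ⟨g ^ 2, hg⟩ ≠ 0 := by
  obtain ⟨n, hn⟩ := Function.ne_iff.mp hf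
  obtain ⟨i, j, hij⟩ := exists_ne_of_mem_V3 (f n).2 (fun h => hn (Subtype.ext h))
  obtain ⟨g, hg⟩ := hsurj (Equiv.swap i j)
  have hne : i ≠ j := fun h => hij (by rw [h])
  have hord : orderOf (Equiv.swap i j) = 2 := Equiv.Perm.IsSwap.orderOf ⟨i, j, hne, rfl⟩
  have hmem : ∀ x : G, π x = Equiv.swap i j → x ^ 2 ∈ N := by
    intro x hx
    rw [← hker, MonoidHom.mem_ker, map_pow, hx, ← hord, pow_orderOf_eq_one]
  by_cases h0 : f ⟨g ^ 2, hmem g hg⟩ = 0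
  · have hπn : π n = 1 := by
      rw [← MonoidHom.mem_ker, hker]
      exact n.2
    have hgn : π (g * n) = Equiv.swap i j := by rw [map_mul, hπn, mul_one, hg]
    refine ⟨g * n, hmem _ hgn, by rw [hgn, hord], ?_⟩
    have hsq : (⟨(g * n) ^ 2, hmem _ hgn⟩ : N) =
        ⟨g * ↑n * g⁻¹, hN.conj_mem ↑n n.2 g⟩ * ⟨g ^ 2, hmem g hg⟩ * n := by
      apply Subtype.ext
      simp only [Subgroup.coe_mul, pow_two]
      group
    rw [hsq, hhom, hhom, hequiv, h0, add_zero, hg]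
    exact permRep_swap_add_self_ne_zero (f n) hij
  · exact ⟨g, hmem g hg, by rw [hg, hord], h0⟩
end
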